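/- Let F be a field, let n > m ≥ 1 and a, b ≥ 1 be integers, set N = abn + m, and let c = (n, …, n, m) be the composition of N with ab parts equal to n followed by one part m. Then there is NO permutation matrix w ∈ GL_N(F) such that w U_{abn, m} w^{−1} ⊆ U_c^−. (This is the key nonexistence claim in the proofs of Proposition 4.4 and of the final contradiction in Section 5, where it forces the vanishing of the constant term along U_{abn,m}.) -/

import Mathlib

open Matrix

/-- The index (0-based) of the block containing position `i` (0-based), for the
composition `c`. -/
def blockOf (c : List ℕ) (i : ℕ) : ℕ :=
  (List.range c.length).countP fun t => decide ((c.take (t + 1)).sum ≤ i)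

/-- `U_c`: the block upper-triangular unipotent matrices for the composition
`c` of `N` (diagonal blocks identity, zero below the block diagonal). -/
def UComp (c : List ℕ) (N : ℕ) (F : Type*) [Field F] :
    Set (Matrix (Fin N) (Fin N) F) :=
  { M | (∀ i, M i i = 1) ∧
      ∀ i j : Fin N, i ≠ j → blockOf c (j : ℕ) ≤ blockOf c (i : ℕ) → M i j = 0 }

/-- `U_c⁻`: the image of `U_c` under matrix transpose. -/
def UCompMinus (c : List ℕ) (N : ℕ) (F : Type*) [Field F] :
    Set (Matrix (Fin N) (Fin N) F) :=
  { M | M.transpose ∈ UComp c N F }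

/-- The permutation matrix attached to `σ` (a Weyl element of `GL_N`). -/
def permMat (N : ℕ) (F : Type*) [Field F] (σ : Equiv.Perm (Fin N)) :
    Matrix (Fin N) (Fin N) F :=
  fun i j => if σ j = i then 1 else 0

theorem blockOf_replicate_append_of_lt {k n i : ℕ} (l : List ℕ) (hk : 1 ≤ k) (hi : i < n) :
    blockOf (List.replicate k n ++ l) i = 0 := by
  obtain ⟨k, rfl⟩ := Nat.exists_eq_add_of_le' hk
  rw [blockOf, List.countP_eq_zero]
  intro t _
  rw [decide_eq_true_eq, List.replicate_succ, List.cons_append, List.take_succ_cons, List.sum_cons]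
  omega

theorem blockOf_pair_lt_of_lt_of_le {p q i j : ℕ} (hi : i < p) (hj : p ≤ j) :
    blockOf [p, q] i < blockOf [p, q] j := by
  have h₁ : ¬ p ≤ i := by omega
  have h₂ : ¬ p + q ≤ i := by omega
  simp [blockOf, List.range_succ, List.countP_cons, h₁, h₂, hj]

theorem transpose_permMat_mul_permMat (N : ℕ) (F : Type*) [Field F] (σ : Equiv.Perm (Fin N)) :
    (permMat N F σ).transpose * permMat N F σ = 1 := by
  ext i j
  simp [Matrix.mul_apply, permMat, Matrix.one_apply, eq_comm]

theorem permMat_conj_apply (N : ℕ) (F : Type*) [Field F] (σ : Equiv.Perm (Fin N))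
    (M : Matrix (Fin N) (Fin N) F) (i j : Fin N) :
    (permMat N F σ * M * (permMat N F σ)⁻¹) (σ i) (σ j) = M i j := by
  rw [Matrix.inv_eq_left_inv (transpose_permMat_mul_permMat N F σ)]
  simp [Matrix.mul_apply, permMat]

theorem one_add_single_mem_UComp {c : List ℕ} {N : ℕ} (F : Type*) [Field F] {i j : Fin N}
    (h : blockOf c i < blockOf c j) : 1 + Matrix.single i j (1 : F) ∈ UComp c N F := by
  refine ⟨fun k => ?_, fun k l hkl hle => ?_⟩
  · have : ¬ (i = k ∧ j = k) := by
      rintro ⟨rfl, rfl⟩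
      exact lt_irrefl _ h
    simp [this]
  · have : ¬ (i = k ∧ j = l) := by
      rintro ⟨rfl, rfl⟩
      exact absurd h hle.not_gt
    simp [this, hkl]

/-- A permutation of `Fin (p + m)` cannot move `n > m` initial positions out of the image of the
first `p` positions. -/
theorem exists_lt_and_perm_apply_lt {N p m n : ℕ} (hN : N = p + m) (hmn : m < n) (hn : n ≤ N)
    (σ : Equiv.Perm (Fin N)) : ∃ i : Fin N, (i : ℕ) < p ∧ (σ i : ℕ) < n := by
  by_contra! h
  have hle (k : Fin n) : p ≤ (σ.symm (Fin.castLE hn k) : ℕ) := by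
    by_contra! hk
    have := h _ hk
    simp at this
    omega
  let f : Fin n → Fin m := fun k => ⟨σ.symm (Fin.castLE hn k) - p, by
    have := (σ.symm (Fin.castLE hn k)).isLt
    have := hle k
    omega⟩
  have hf : Function.Injective f := by
    intro k l hkl
    have hkl' := congrArg Fin.val hkl
    simp only [f] at hkl'
    have h₁ := hle k
    have h₂ := hle l
    have h₃ : σ.symm (Fin.castLE hn k) = σ.symm (Fin.castLE hn l) := Fin.ext (by omega)
    simpa using h₃
  have := Fintype.card_le_of_injective f hf
  simp at this
  omega

/-- For `N = abn + m` with `1 ≤ m < n` and `c = (n, …, n, m)` (`ab` parts `n`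
and one part `m`), there is no permutation matrix `w` with
`w U_{abn, m} w⁻¹ ⊆ U_c⁻`. -/
theorem stmt8 (F : Type*) [Field F] (n m a b : ℕ) (hm : 1 ≤ m) (hmn : m < n)
    (ha : 1 ≤ a) (hb : 1 ≤ b) (N : ℕ) (hN : N = a * b * n + m) :
    ¬ ∃ σ : Equiv.Perm (Fin N),
        ∀ M ∈ UComp [a * b * n, m] N F,
          permMat N F σ * M * (permMat N F σ)⁻¹ ∈
            UCompMinus (List.replicate (a * b) n ++ [m]) N F := by
  rintro ⟨σ, hσ⟩
  have hab : 1 ≤ a * b := Nat.mul_pos ha hb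
  have hn : n ≤ N := hN ▸ (Nat.le_mul_of_pos_left n hab).trans (Nat.le_add_right _ _)
  obtain ⟨i, hi, hσi⟩ := exists_lt_and_perm_apply_lt hN hmn hn σ
  let j : Fin N := ⟨a * b * n, by omega⟩
  have hij : i ≠ j := fun h => hi.ne (congrArg Fin.val h)
  have hmem := hσ _ (one_add_single_mem_UComp F
    (blockOf_pair_lt_of_lt_of_le (q := m) hi (le_refl (j : ℕ))))
  have hzero := hmem.2 (σ j) (σ i) (σ.injective.ne hij.symm)
    (by rw [blockOf_replicate_append_of_lt [m] hab hσi]; exact Nat.zero_le _)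
  rw [Matrix.transpose_apply, permMat_conj_apply] at hzero
  simp [hij] at hzero
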